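/- Let R be the unicyclic generator on n ≥ 3 states with rates k⁺ᵢ > 0 and k⁻ᵢ > 0, with finite cycle affinity F ≥ 0. Let λ be a nonreal eigenvalue of R with left eigenvector u and winding number w = ω(u). Then |Im λ|/(−Re λ) ≤ F/(2πw), and consequently |Im λ|/(−Re λ) ≤ F/(2π). -/

import Mathlib

open Matrix Finset

/-- Wrapped frequency `|k|ₙ := min (k mod n) ((n - k) mod n)`. -/
def wrapIdx (n : ℕ) (k : ℤ) : ℤ :=
  min (k % (n : ℤ)) (((n : ℤ) - k) % (n : ℤ))

/-- Winding number `ω(u)` of a vector `u` around the unicycle: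
`|(1/2π) ∑ᵢ Arg (u_{i+1}/uᵢ)|ₙ` (the sum divided by `2π` is an integer
whenever `u` is an eigenvector with all components nonzero). -/
noncomputable def windingNum (n : ℕ) [NeZero n] (u : ZMod n → ℂ) : ℤ :=
  wrapIdx n (round ((∑ i : ZMod n, Complex.arg (u (i + 1) / u i)) / (2 * Real.pi)))

/-- The unicyclic generator on `n` states with forward rates `kp` and backward
rates `km`, viewed as a complex matrix: `R j i = kpᵢ` if `j = i+1`, `kmᵢ` if
`j = i-1`, `-(kpᵢ+kmᵢ)` if `j = i`, and `0` otherwise. -/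
noncomputable def uniGenC (n : ℕ) [NeZero n] (kp km : ZMod n → ℝ) :
    Matrix (ZMod n) (ZMod n) ℂ :=
  Matrix.of fun j i =>
    if j = i + 1 then (kp i : ℂ)
    else if j = i - 1 then (km i : ℂ)
    else if j = i then -((kp i : ℂ) + (km i : ℂ))
    else 0

/-- `T = tanh (F / 2n)` where `F = ∑ᵢ ln (kpᵢ/kmᵢ)` is the cycle affinity;
`T = 1` when the affinity is infinite (some `kmᵢ = 0`). -/
noncomputable def uniT (n : ℕ) [NeZero n] (kp km : ZMod n → ℝ) : ℝ :=
  open Classical in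
  if ∀ i, km i ≠ 0 then
    Real.tanh ((∑ i : ZMod n, Real.log (kp i / km i)) / (2 * n))
  else 1

theorem ZMod.forall_of_succ {n : ℕ} [NeZero n] {P : ZMod n → Prop} {i : ZMod n} (h : P i)
    (hs : ∀ j, P j → P (j + 1)) (j : ZMod n) : P j := by
  have key : ∀ k : ℕ, P (i + k) := by
    intro k
    induction k with
    | zero => simpa using h
    | succ k ih => simpa [add_assoc] using hs _ ih
  simpa using key (j - i).val

theorem ZMod.sum_add_one {n : ℕ} [NeZero n] (f : ZMod n → ℝ) :
    ∑ i, f (i + 1) = ∑ i, f i :=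
  Equiv.sum_comp (Equiv.addRight (1 : ZMod n)) f

theorem ZMod.sum_log_norm_div {n : ℕ} [NeZero n] {u : ZMod n → ℂ} (h0 : ∀ i, u i ≠ 0) :
    ∑ i, Real.log ‖u (i + 1) / u i‖ = 0 := by
  have h : ∀ i, Real.log ‖u (i + 1) / u i‖ = Real.log ‖u (i + 1)‖ - Real.log ‖u i‖ := by
    intro i
    rw [norm_div, Real.log_div (norm_ne_zero_iff.2 (h0 _)) (norm_ne_zero_iff.2 (h0 _))]
  simp only [h, Finset.sum_sub_distrib]
  rw [ZMod.sum_add_one (fun i => Real.log ‖u i‖), sub_self]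

theorem ZMod.exists_sum_arg_div {n : ℕ} [NeZero n] {u : ZMod n → ℂ} (h0 : ∀ i, u i ≠ 0) :
    ∃ N : ℤ, ∑ i, Complex.arg (u (i + 1) / u i) = 2 * Real.pi * N := by
  have hexp : ∀ i, u (i + 1) / u i =
      ‖u (i + 1) / u i‖ * Complex.exp (Complex.arg (u (i + 1) / u i) * Complex.I) :=
    fun i => (Complex.norm_mul_exp_arg_mul_I _).symm
  have hprod : ∏ i, u (i + 1) / u i = 1 := by
    have h : ∏ i, u (i + 1) = ∏ i, u i := Equiv.prod_comp (Equiv.addRight (1 : ZMod n)) u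
    rw [Finset.prod_div_distrib, h]
    exact div_self (Finset.prod_ne_zero_iff.2 fun i _ => h0 i)
  have hnorm : ∏ i, ((‖u (i + 1) / u i‖ : ℝ) : ℂ) = 1 := by
    rw [← Complex.ofReal_prod, ← norm_prod, hprod]
    simp
  have h1 : Complex.exp (((∑ i, Complex.arg (u (i + 1) / u i) : ℝ) : ℂ) * Complex.I) = 1 := by
    rw [← hprod, Finset.prod_congr rfl fun i _ => hexp i, Finset.prod_mul_distrib, hnorm, one_mul,
      ← Complex.exp_sum, Complex.ofReal_sum, Finset.sum_mul]
  obtain ⟨N, hN⟩ := Complex.exp_eq_one_iff.1 h1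
  refine ⟨N, ?_⟩
  have h2 : ((∑ i, Complex.arg (u (i + 1) / u i) : ℝ) : ℂ) = ((2 * Real.pi * N : ℝ) : ℂ) := by
    apply mul_right_cancel₀ Complex.I_ne_zero
    rw [hN]
    push_cast
    ring
  exact_mod_cast h2

theorem sin_add_mul_cos_pos {ρ x y : ℝ} (hρ : 0 < ρ) (hx : 0 < x) (hxy : x ≤ y)
    (hy : y < Real.pi) (h : 0 < Real.sin y + ρ * Real.cos y) :
    0 < Real.sin x + ρ * Real.cos x := by
  have sx := Real.sin_pos_of_pos_of_lt_pi hx (by linarith)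
  have sy := Real.sin_pos_of_pos_of_lt_pi (by linarith) hy
  have hd : 0 ≤ Real.sin (y - x) :=
    Real.sin_nonneg_of_nonneg_of_le_pi (by linarith) (by linarith)
  rw [Real.sin_sub] at hd
  have h2 : 0 < (Real.sin x + ρ * Real.cos x) * Real.sin y := by
    have := mul_pos h sx
    have := mul_nonneg hρ.le hd
    nlinarith
  exact pos_of_mul_pos_left h2 sy.le

theorem log_sin_add_mul_cos_le {ρ x y : ℝ} (hρ : 0 < ρ) (hx : 0 < x) (hxy : x ≤ y)
    (hy : y < Real.pi) (h : 0 < Real.sin y + ρ * Real.cos y) :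
    Real.log (Real.sin y + ρ * Real.cos y) + ρ * y - (1 + ρ ^ 2) * Real.log (Real.sin y) ≤
    Real.log (Real.sin x + ρ * Real.cos x) + ρ * x - (1 + ρ ^ 2) * Real.log (Real.sin x) := by
  have hS : ∀ t ∈ Set.Icc x y, 0 < Real.sin t + ρ * Real.cos t := by
    intro t ht
    exact sin_add_mul_cos_pos hρ (by linarith [ht.1]) ht.2 hy h
  have hs : ∀ t ∈ Set.Icc x y, 0 < Real.sin t := fun t ht =>
    Real.sin_pos_of_pos_of_lt_pi (by linarith [ht.1]) (by linarith [ht.2])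
  have hder : ∀ t ∈ Set.Icc x y, HasDerivAt
      (fun t => Real.log (Real.sin t + ρ * Real.cos t) + ρ * t - (1 + ρ ^ 2) * Real.log (Real.sin t))
      ((Real.cos t + ρ * -Real.sin t) / (Real.sin t + ρ * Real.cos t) + ρ * 1
        - (1 + ρ ^ 2) * (Real.cos t / Real.sin t)) t := by
    intro t ht
    exact ((((Real.hasDerivAt_sin t).add ((Real.hasDerivAt_cos t).const_mul ρ)).log
      (hS t ht).ne').add ((hasDerivAt_id t).const_mul ρ)).sub
      (((Real.hasDerivAt_sin t).log (hs t ht).ne').const_mul _)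
  have hanti := antitoneOn_of_hasDerivWithinAt_nonpos (convex_Icc x y)
    (fun t ht => (hder t ht).continuousAt.continuousWithinAt)
    (fun t ht => (hder t (interior_subset ht)).hasDerivWithinAt) (by
      intro t ht
      have h1 := hS t (interior_subset ht)
      have h2 := hs t (interior_subset ht)
      have : (Real.cos t + ρ * -Real.sin t) / (Real.sin t + ρ * Real.cos t) + ρ * 1
        - (1 + ρ ^ 2) * (Real.cos t / Real.sin t) =
        -((1 + ρ ^ 2) * ρ * Real.cos t ^ 2 / ((Real.sin t + ρ * Real.cos t) * Real.sin t)) := by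
        have h3 := h1.ne'
        have h4 := h2.ne'
        obtain ⟨S, hS⟩ : ∃ S, S = Real.sin t + ρ * Real.cos t := ⟨_, rfl⟩
        rw [← hS] at h3 ⊢
        field_simp
        rw [hS]
        ring
      rw [this, neg_nonpos]
      positivity)
  exact hanti (Set.left_mem_Icc.2 hxy) (Set.right_mem_Icc.2 hxy) hxy

theorem Complex.arg_mem_Ioo_of_im_pos {z : ℂ} (hz : 0 < z.im) : z.arg ∈ Set.Ioo 0 Real.pi :=
  ⟨lt_of_le_of_ne (Complex.arg_nonneg_iff.2 hz.le)
      fun h => hz.ne' (Complex.arg_eq_zero_iff.1 h.symm).2,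
    lt_of_le_of_ne (Complex.arg_le_pi z) fun h => hz.ne' (Complex.arg_eq_pi_iff.1 h).2⟩

theorem Complex.im_one_sub_inv_pos {z : ℂ} (hz : 0 < z.im) : 0 < (1 - z⁻¹).im := by
  have : z ≠ 0 := fun h => by simp [h] at hz
  have := Complex.normSq_pos.2 this
  rw [Complex.sub_im, Complex.one_im, Complex.inv_im]
  have : 0 < z.im / Complex.normSq z := by positivity
  rw [neg_div]
  linarith

theorem Complex.arg_sub_one_eq {z : ℂ} (hz : 0 < z.im) :
    (z - 1).arg = (1 - z⁻¹).arg + z.arg := by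
  have hz0 : z ≠ 0 := fun h => by simp [h] at hz
  have hw := Complex.im_one_sub_inv_pos hz
  have hw0 : 1 - z⁻¹ ≠ 0 := fun h => by simp [h] at hw
  have hv : 0 < (z - 1).im := by simpa using hz
  have hvw : z - 1 = (1 - z⁻¹) * z := by field_simp
  have h := Complex.arg_mul_coe_angle hw0 hz0
  rw [← hvw, ← Real.Angle.coe_add, Real.Angle.angle_eq_iff_two_pi_dvd_sub] at h
  obtain ⟨k, hk⟩ := h
  obtain ⟨h1, h2⟩ := Complex.arg_mem_Ioo_of_im_pos hz
  obtain ⟨h3, h4⟩ := Complex.arg_mem_Ioo_of_im_pos hw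
  obtain ⟨h5, h6⟩ := Complex.arg_mem_Ioo_of_im_pos hv
  have hpi := Real.pi_pos
  have hk1 : (-1 : ℝ) < k := by
    by_contra! hc
    nlinarith
  have hk2 : (k : ℝ) < 1 := by
    by_contra! hc
    nlinarith
  have hk0 : k = 0 := by
    have : -1 < k := by exact_mod_cast hk1
    have : k < 1 := by exact_mod_cast hk2
    omega
  rw [hk0] at hk
  simp at hk
  linarith

theorem Complex.im_add_mul_re_eq (ρ : ℝ) (v : ℂ) :
    v.im + ρ * v.re = ‖v‖ * (Real.sin v.arg + ρ * Real.cos v.arg) := by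
  rw [mul_add, mul_left_comm, Complex.norm_mul_sin_arg, Complex.norm_mul_cos_arg]

theorem Complex.log_im_add_mul_re_bound {z : ℂ} {ρ : ℝ} (hρ : 0 < ρ) (hz : 0 < z.im)
    (hA : 0 < (z - 1).im + ρ * (z - 1).re) :
    0 < (1 - z⁻¹).im + ρ * (1 - z⁻¹).re ∧
    ρ * z.arg - (2 + ρ ^ 2) * Real.log ‖z‖ ≤
      Real.log ((1 - z⁻¹).im + ρ * (1 - z⁻¹).re) - Real.log ((z - 1).im + ρ * (z - 1).re) := by
  have hz0 : z ≠ 0 := fun h => by simp [h] at hz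
  have hw := Complex.im_one_sub_inv_pos hz
  have hw0 : 1 - z⁻¹ ≠ 0 := fun h => by simp [h] at hw
  have hv : 0 < (z - 1).im := by simpa using hz
  have hv0 : z - 1 ≠ 0 := fun h => by simp [h] at hv
  have hvw : ‖z - 1‖ = ‖1 - z⁻¹‖ * ‖z‖ := by
    rw [← norm_mul]
    congr 1
    field_simp
  have hnz : 0 < ‖z‖ := norm_pos_iff.2 hz0
  have hnw : 0 < ‖1 - z⁻¹‖ := norm_pos_iff.2 hw0
  have hnv : 0 < ‖z - 1‖ := norm_pos_iff.2 hv0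
  have harg := Complex.arg_sub_one_eq hz
  obtain ⟨h1, h2⟩ := Complex.arg_mem_Ioo_of_im_pos hz
  obtain ⟨h3, h4⟩ := Complex.arg_mem_Ioo_of_im_pos hw
  obtain ⟨h5, h6⟩ := Complex.arg_mem_Ioo_of_im_pos hv
  rw [Complex.im_add_mul_re_eq] at hA
  rw [Complex.im_add_mul_re_eq, Complex.im_add_mul_re_eq]
  have hSv := pos_of_mul_pos_right hA hnv.le
  have hle : (1 - z⁻¹).arg ≤ (z - 1).arg := by linarith
  have hSw := sin_add_mul_cos_pos hρ h3 hle h6 hSv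
  refine ⟨mul_pos hnw hSw, ?_⟩
  have hK := log_sin_add_mul_cos_le hρ h3 hle h6 hSv
  have hsv := Real.sin_pos_of_pos_of_lt_pi h5 h6
  have hsw := Real.sin_pos_of_pos_of_lt_pi h3 h4
  have hsin : Real.sin (z - 1).arg = ‖z‖ * Real.sin (1 - z⁻¹).arg := by
    have e1 := Complex.norm_mul_sin_arg (z - 1)
    have e2 := Complex.norm_mul_sin_arg (1 - z⁻¹)
    have e3 : (1 - z⁻¹).im * ‖z‖ ^ 2 = (z - 1).im := by
      rw [← Complex.normSq_eq_norm_sq]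
      have := (Complex.normSq_pos.2 hz0).ne'
      simp [Complex.inv_im]
      field_simp
    rw [← e1, ← e2, hvw] at e3
    have : ‖1 - z⁻¹‖ * ‖z‖ * (Real.sin (z - 1).arg - ‖z‖ * Real.sin (1 - z⁻¹).arg) = 0 := by
      linear_combination -e3
    have := (mul_eq_zero.1 this).resolve_left (by positivity)
    linarith
  have hlog : Real.log (Real.sin (z - 1).arg) =
      Real.log ‖z‖ + Real.log (Real.sin (1 - z⁻¹).arg) := by
    rw [hsin, Real.log_mul hnz.ne' hsw.ne']
  rw [Real.log_mul hnw.ne' hSw.ne', Real.log_mul hnv.ne' hSv.ne', hvw,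
    Real.log_mul hnw.ne' hnz.ne']
  rw [hlog, harg] at hK
  rw [harg]
  linarith

theorem uniGenC_transpose_mulVec {n : ℕ} [NeZero n] (hn : 3 ≤ n) (kp km : ZMod n → ℝ)
    (u : ZMod n → ℂ) (i : ZMod n) :
    ((uniGenC n kp km)ᵀ *ᵥ u) i =
      kp i * u (i + 1) + km i * u (i - 1) - (kp i + km i) * u i := by
  have : Fact (1 < n) := ⟨by omega⟩
  have h2 : (2 : ZMod n) ≠ 0 := by
    intro h
    have : ((2 : ℕ) : ZMod n) = 0 := by exact_mod_cast h
    rw [ZMod.natCast_eq_zero_iff] at this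
    exact absurd (Nat.le_of_dvd (by norm_num) this) (by omega)
  have hpm : i - 1 ≠ i + 1 := fun h => h2 (by linear_combination -h)
  have hp : i ≠ i + 1 := fun h => one_ne_zero (α := ZMod n) (by linear_combination -h)
  have hm : i ≠ i - 1 := fun h => one_ne_zero (α := ZMod n) (by linear_combination h)
  have key : ∀ j, uniGenC n kp km j i * u j =
      (if j = i + 1 then (kp i : ℂ) * u j else 0) + (if j = i - 1 then (km i : ℂ) * u j else 0)
      + (if j = i then -((kp i : ℂ) + km i) * u j else 0) := by
    intro j
    simp only [uniGenC, Matrix.of_apply]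
    by_cases h1 : j = i + 1
    · subst h1
      simp [hpm.symm, hp.symm]
    by_cases h3 : j = i - 1
    · subst h3
      simp [hpm, hm.symm]
    by_cases h4 : j = i
    · subst h4
      simp [hp, hm]
    simp [h1, h3, h4]
  simp only [Matrix.mulVec, dotProduct, Matrix.transpose_apply, key, Finset.sum_add_distrib,
    Finset.sum_ite_eq', Finset.mem_univ, if_true]
  ring

section Eigenvector

variable {n : ℕ} {kp km : ZMod n → ℝ} {lam : ℂ} {u : ZMod n → ℂ}

theorem current_balance
    (heig : ∀ i, kp i * u (i + 1) + km i * u (i - 1) - (kp i + km i) * u i = lam * u i)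
    (i : ZMod n) :
    kp i * ((u i).re * (u (i + 1)).im - (u i).im * (u (i + 1)).re) -
      km i * ((u (i - 1)).re * (u i).im - (u (i - 1)).im * (u i).re) =
      lam.im * Complex.normSq (u i) := by
  have hre := congrArg Complex.re (heig i)
  have him := congrArg Complex.im (heig i)
  simp at hre him
  rw [Complex.normSq_apply]
  linear_combination (u i).re * him - (u i).im * hre

theorem rate_balance
    (hre : lam.re < 0) (h0 : ∀ i, u i ≠ 0)
    (heig : ∀ i, kp i * u (i + 1) + km i * u (i - 1) - (kp i + km i) * u i = lam * u i)
    (i : ZMod n) :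
    kp i * ((u (i + 1) / u i - 1).im + lam.im / -lam.re * (u (i + 1) / u i - 1).re) =
      km i * ((1 - (u i / u (i - 1))⁻¹).im + lam.im / -lam.re * (1 - (u i / u (i - 1))⁻¹).re) := by
  have h : kp i * (u (i + 1) / u i - 1) - km i * (1 - (u i / u (i - 1))⁻¹) = lam := by
    have := h0 i
    rw [inv_div]
    field_simp
    linear_combination heig i
  have h1 := congrArg Complex.re h
  have h2 := congrArg Complex.im h
  rw [Complex.sub_re, Complex.re_ofReal_mul, Complex.re_ofReal_mul] at h1
  rw [Complex.sub_im, Complex.im_ofReal_mul, Complex.im_ofReal_mul] at h2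
  have h3 : lam.im / -lam.re * lam.re = -lam.im := by
    rw [div_neg, neg_mul, div_mul_cancel₀ _ hre.ne]
  linear_combination h2 + lam.im / -lam.re * h1 + h3

variable [NeZero n]

theorem ne_zero_of_eigenvector (hkp : ∀ i, 0 < kp i) (hkm : ∀ i, 0 < km i)
    (hlam : 0 < lam.im) (hu : u ≠ 0)
    (heig : ∀ i, kp i * u (i + 1) + km i * u (i - 1) - (kp i + km i) * u i = lam * u i)
    (i : ZMod n) : u i ≠ 0 := by
  intro hi
  have hJ := current_balance heig
  set J : ZMod n → ℝ := fun i => (u i).re * (u (i + 1)).im - (u i).im * (u (i + 1)).re with hJdef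
  have hJ' : ∀ j, kp (j + 1) * J (j + 1) = km (j + 1) * J j +
      lam.im * Complex.normSq (u (j + 1)) := by
    intro j
    have := hJ (j + 1)
    simp only [add_sub_cancel_right] at this
    simp only [hJdef]
    linarith
  have hJi : J i = 0 := by simp [hJdef, hi]
  have hnn : ∀ j, 0 ≤ J j := ZMod.forall_of_succ hJi.ge fun j hj => by
    have h1 := hJ' j
    have h2 : 0 ≤ kp (j + 1) * J (j + 1) := by
      rw [h1]
      have := hkm (j + 1)
      have := Complex.normSq_nonneg (u (j + 1))
      positivity
    exact nonneg_of_mul_nonneg_right h2 (hkp _)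
  have hpos : ∀ j, ¬ 0 < J j := by
    intro j hj
    have := ZMod.forall_of_succ (P := fun j => 0 < J j) hj (fun j hj => by
      have h1 := hJ' j
      have h2 : 0 < kp (j + 1) * J (j + 1) := by
        rw [h1]
        have := hkm (j + 1)
        have := Complex.normSq_nonneg (u (j + 1))
        positivity
      exact pos_of_mul_pos_right h2 (hkp _).le) i
    exact this.ne' hJi
  have hz : ∀ j, J j = 0 := fun j => le_antisymm (not_lt.1 (hpos j)) (hnn j)
  apply hu
  funext j
  have h1 := hJ' (j - 1)
  rw [hz, hz, sub_add_cancel, mul_zero, mul_zero, zero_add] at h1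
  simpa using (mul_eq_zero.1 h1.symm).resolve_left hlam.ne'

theorem im_div_pos_of_eigenvector (hkp : ∀ i, 0 < kp i) (hkm : ∀ i, 0 < km i)
    (hF : 0 ≤ ∑ i : ZMod n, Real.log (kp i / km i))
    (hlam : 0 < lam.im) (h0 : ∀ i, u i ≠ 0)
    (heig : ∀ i, kp i * u (i + 1) + km i * u (i - 1) - (kp i + km i) * u i = lam * u i)
    (i : ZMod n) : 0 < (u (i + 1) / u i).im := by
  have hJ := current_balance heig
  set J : ZMod n → ℝ := fun i => (u i).re * (u (i + 1)).im - (u i).im * (u (i + 1)).re with hJdef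
  have hJ' : ∀ j, kp (j + 1) * J (j + 1) = km (j + 1) * J j +
      lam.im * Complex.normSq (u (j + 1)) := by
    intro j
    have := hJ (j + 1)
    simp only [add_sub_cancel_right] at this
    simp only [hJdef]
    linarith
  have hq : ∀ j, 0 < Complex.normSq (u j) := fun j => Complex.normSq_pos.2 (h0 j)
  have hstep : ∀ j, 0 ≤ J j → 0 < J (j + 1) := fun j hj => by
    have h1 := hJ' j
    have h2 : 0 < kp (j + 1) * J (j + 1) := by
      rw [h1]
      have := hkm (j + 1)
      have := hq (j + 1)
      positivity
    exact pos_of_mul_pos_right h2 (hkp _).le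
  have hpos : ∀ j, 0 < J j := by
    by_cases hex : ∃ j, 0 ≤ J j
    · obtain ⟨j, hj⟩ := hex
      exact ZMod.forall_of_succ (hstep j hj) fun k hk => hstep k hk.le
    · exfalso
      push Not at hex
      have hlt : ∀ j, Real.log (kp (j + 1) / km (j + 1)) <
          Real.log (-J j) - Real.log (-J (j + 1)) := by
        intro j
        have h1 : 0 < -J j := by linarith [hex j]
        have h2 : 0 < -J (j + 1) := by linarith [hex (j + 1)]
        rw [← Real.log_div h1.ne' h2.ne']
        apply Real.log_lt_log (div_pos (hkp _) (hkm _))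
        rw [div_lt_div_iff₀ (hkm _) h2]
        have := hJ' j
        have := mul_pos hlam (hq (j + 1))
        linarith
      have hsum := Finset.sum_lt_sum_of_nonempty (s := (Finset.univ : Finset (ZMod n)))
        Finset.univ_nonempty fun j _ => hlt j
      rw [ZMod.sum_add_one (fun j => Real.log (kp j / km j)), Finset.sum_sub_distrib,
        ZMod.sum_add_one (fun j => Real.log (-J j)), sub_self] at hsum
      linarith
  have h1 : (u (i + 1) / u i).im = J i / Complex.normSq (u i) := by
    rw [Complex.div_im, hJdef]
    ring
  rw [h1]
  exact div_pos (hpos i) (hq i)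

theorem ratio_mul_sum_arg_le (hkp : ∀ i, 0 < kp i) (hkm : ∀ i, 0 < km i)
    (hlam : 0 < lam.im) (hre : lam.re < 0) (h0 : ∀ i, u i ≠ 0)
    (him : ∀ i, 0 < (u (i + 1) / u i).im)
    (heig : ∀ i, kp i * u (i + 1) + km i * u (i - 1) - (kp i + km i) * u i = lam * u i) :
    lam.im / -lam.re * ∑ i, Complex.arg (u (i + 1) / u i) ≤
      ∑ i : ZMod n, Real.log (kp i / km i) := by
  have hbal := rate_balance hre h0 heig
  have hlogz := ZMod.sum_log_norm_div h0
  have hρ : 0 < lam.im / -lam.re := div_pos hlam (by linarith)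
  set ρ := lam.im / -lam.re
  set z : ZMod n → ℂ := fun i => u (i + 1) / u i with hz
  set A : ZMod n → ℝ := fun i => (z i - 1).im + ρ * (z i - 1).re with hA
  set B : ZMod n → ℝ := fun i => (1 - (z i)⁻¹).im + ρ * (1 - (z i)⁻¹).re with hB
  have hAB : ∀ i, kp (i + 1) * A (i + 1) = km (i + 1) * B i := by
    intro i
    have := hbal (i + 1)
    simpa only [add_sub_cancel_right] using this
  have hApos : ∀ i, 0 < A i := by
    by_cases hex : ∃ i, 0 < A i
    · obtain ⟨i, hi⟩ := hex
      refine ZMod.forall_of_succ hi fun j hj => ?_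
      have h1 : 0 < kp (j + 1) * A (j + 1) := by
        rw [hAB]
        exact mul_pos (hkm _) (Complex.log_im_add_mul_re_bound hρ (him j) hj).1
      exact pos_of_mul_pos_right h1 (hkp _).le
    · exfalso
      push Not at hex
      have hlt : ∀ i, Real.log ‖z i‖ < 0 := by
        intro i
        have hzi : z i ≠ 0 := div_ne_zero (h0 _) (h0 _)
        have h1 : km (i + 1) * B i ≤ 0 := by
          rw [← hAB]
          exact mul_nonpos_of_nonneg_of_nonpos (hkp _).le (hex _)
        have h2 : B i ≤ 0 := nonpos_of_mul_nonpos_right h1 (hkm _)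
        have h3 := Complex.im_one_sub_inv_pos (him i)
        have h4 : (1 - (z i)⁻¹).re < 0 := by
          by_contra! hc
          have := mul_nonneg hρ.le hc
          simp only [hB] at h2
          linarith
        have h5 : 1 < ‖(z i)⁻¹‖ := by
          have := Complex.re_le_norm (z i)⁻¹
          rw [Complex.sub_re, Complex.one_re] at h4
          linarith
        have h6 := Real.log_pos h5
        rw [norm_inv, Real.log_inv] at h6
        linarith
      have := Finset.sum_lt_sum_of_nonempty (s := (Finset.univ : Finset (ZMod n)))
        Finset.univ_nonempty fun i _ => hlt i
      rw [Finset.sum_const_zero] at this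
      linarith
  have hedge := fun i => Complex.log_im_add_mul_re_bound hρ (him i) (hApos i)
  have hlog : ∀ i, Real.log (kp (i + 1) / km (i + 1)) = Real.log (B i) - Real.log (A (i + 1)) := by
    intro i
    rw [← Real.log_div (hedge i).1.ne' (hApos _).ne']
    congr 1
    rw [div_eq_div_iff (hkm _).ne' (hApos _).ne', hAB, mul_comm]
  have hsum : ∑ i, Real.log (kp i / km i) = ∑ i, (Real.log (B i) - Real.log (A i)) := by
    rw [← ZMod.sum_add_one (fun i => Real.log (kp i / km i)), Finset.sum_congr rfl
      fun i _ => hlog i, Finset.sum_sub_distrib, Finset.sum_sub_distrib,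
      ZMod.sum_add_one (fun i => Real.log (A i))]
  rw [hsum]
  have hle := Finset.sum_le_sum fun i (_ : i ∈ (Finset.univ : Finset (ZMod n))) => (hedge i).2
  rw [Finset.sum_sub_distrib, ← Finset.mul_sum, ← Finset.mul_sum, hlogz, mul_zero, sub_zero] at hle
  exact hle

theorem exists_winding_of_im_pos (hkp : ∀ i, 0 < kp i) (hkm : ∀ i, 0 < km i)
    (hF : 0 ≤ ∑ i : ZMod n, Real.log (kp i / km i))
    (hlam : 0 < lam.im) (hu : u ≠ 0)
    (heig : ∀ i, kp i * u (i + 1) + km i * u (i - 1) - (kp i + km i) * u i = lam * u i) :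
    (∀ i, 0 < (u (i + 1) / u i).im) ∧
    ∃ N : ℤ, 0 < N ∧ 2 * N < n ∧ ∑ i, Complex.arg (u (i + 1) / u i) = 2 * Real.pi * N ∧
      lam.im / -lam.re ≤ (∑ i : ZMod n, Real.log (kp i / km i)) / (2 * Real.pi * N) := by
  have h0 := ne_zero_of_eigenvector hkp hkm hlam hu heig
  have him := im_div_pos_of_eigenvector hkp hkm hF hlam h0 heig
  refine ⟨him, ?_⟩
  obtain ⟨N, hN⟩ := ZMod.exists_sum_arg_div h0
  have hpi := Real.pi_pos
  have hpos : 0 < ∑ i, Complex.arg (u (i + 1) / u i) :=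
    Finset.sum_pos (fun i _ => (Complex.arg_mem_Ioo_of_im_pos (him i)).1) Finset.univ_nonempty
  have hlt : ∑ i, Complex.arg (u (i + 1) / u i) < ∑ _i : ZMod n, Real.pi :=
    Finset.sum_lt_sum_of_nonempty Finset.univ_nonempty
      fun i _ => (Complex.arg_mem_Ioo_of_im_pos (him i)).2
  rw [Finset.sum_const, Finset.card_univ, ZMod.card, nsmul_eq_mul, hN] at hlt
  have hN0 : (0 : ℝ) < N := by
    rw [hN] at hpos
    exact pos_of_mul_pos_right hpos (by positivity)
  have hNn : (2 * N : ℝ) < n := by nlinarith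
  refine ⟨N, by exact_mod_cast hN0, by exact_mod_cast hNn, hN, ?_⟩
  rcases lt_or_ge lam.re 0 with hre | hre
  · rw [le_div_iff₀ (by positivity), ← hN]
    exact ratio_mul_sum_arg_le hkp hkm hlam hre h0 him heig
  · exact (div_nonpos_of_nonneg_of_nonpos hlam.le (by linarith)).trans (by positivity)

end Eigenvector

theorem wrapIdx_of_pos {n : ℕ} {N : ℤ} (h0 : 0 < N) (h1 : 2 * N < n) : wrapIdx n N = N := by
  rw [wrapIdx, Int.emod_eq_of_lt (by omega) (by omega), Int.emod_eq_of_lt (by omega) (by omega)]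
  omega

theorem wrapIdx_neg (n : ℕ) (N : ℤ) : wrapIdx n (-N) = wrapIdx n N := by
  have h1 : ((n : ℤ) - -N) % n = N % n := by
    rw [sub_neg_eq_add, Int.add_emod_left]
  have h2 : ((n : ℤ) - N) % n = -N % n := by
    rw [sub_eq_add_neg, Int.add_emod_left]
  rw [wrapIdx, wrapIdx, h1, h2, min_comm]

theorem windingNum_of_sum_arg {n : ℕ} [NeZero n] {u : ZMod n → ℂ} {N : ℤ}
    (h : ∑ i, Complex.arg (u (i + 1) / u i) = 2 * Real.pi * N) :
    windingNum n u = wrapIdx n N := by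
  rw [windingNum, h, mul_div_cancel_left₀ _ (by positivity), round_intCast]

theorem unicyclic_size_independent_primal
    (n : ℕ) [NeZero n] (hn : 3 ≤ n)
    (kp km : ZMod n → ℝ) (hkp : ∀ i, 0 < kp i) (hkm : ∀ i, 0 < km i)
    (hF : 0 ≤ ∑ i : ZMod n, Real.log (kp i / km i))
    (lam : ℂ) (hlam : lam.im ≠ 0)
    (u : ZMod n → ℂ) (hu : u ≠ 0)
    (heig : (uniGenC n kp km)ᵀ *ᵥ u = lam • u) :
    |lam.im| / (-lam.re) ≤
      (∑ i : ZMod n, Real.log (kp i / km i)) / (2 * Real.pi * (windingNum n u : ℝ)) ∧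
    |lam.im| / (-lam.re) ≤
      (∑ i : ZMod n, Real.log (kp i / km i)) / (2 * Real.pi) := by
  have heq : ∀ i, kp i * u (i + 1) + km i * u (i - 1) - (kp i + km i) * u i = lam * u i := by
    intro i
    rw [← uniGenC_transpose_mulVec hn, heig]
    rfl
  have hw : ∃ N : ℤ, 0 < N ∧ windingNum n u = N ∧ |lam.im| / -lam.re ≤
      (∑ i : ZMod n, Real.log (kp i / km i)) / (2 * Real.pi * N) := by
    rcases hlam.lt_or_gt with hneg | hpos
    · have hconj : ∀ i, kp i * star u (i + 1) + km i * star u (i - 1)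
          - (kp i + km i) * star u i = star lam * star u i := by
        intro i
        simpa using congrArg (starRingEnd ℂ) (heq i)
      obtain ⟨him, N, hN0, hNn, hN, hle⟩ := exists_winding_of_im_pos hkp hkm hF
        (lam := star lam) (by simpa using hneg) (star_ne_zero.2 hu) hconj
      refine ⟨N, hN0, ?_, by simpa [abs_of_neg hneg] using hle⟩
      have hsum : ∑ i, Complex.arg (u (i + 1) / u i) = 2 * Real.pi * (-N : ℤ) := by
        rw [Int.cast_neg, mul_neg, ← hN, ← Finset.sum_neg_distrib]
        refine Finset.sum_congr rfl fun i _ => ?_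
        have h1 : u (i + 1) / u i = (starRingEnd ℂ) (star u (i + 1) / star u i) := by simp
        rw [h1, Complex.arg_conj, if_neg (Complex.arg_mem_Ioo_of_im_pos (him i)).2.ne]
      rw [windingNum_of_sum_arg hsum, wrapIdx_neg, wrapIdx_of_pos hN0 hNn]
    · obtain ⟨-, N, hN0, hNn, hN, hle⟩ := exists_winding_of_im_pos hkp hkm hF hpos hu heq
      exact ⟨N, hN0, by rw [windingNum_of_sum_arg hN, wrapIdx_of_pos hN0 hNn],
        by rwa [abs_of_pos hpos]⟩
  obtain ⟨N, hN0, hN, hle⟩ := hw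
  rw [hN]
  refine ⟨hle, hle.trans ?_⟩
  have hN1 : (1 : ℝ) ≤ N := by exact_mod_cast hN0
  have hpi := Real.pi_pos
  exact div_le_div_of_nonneg_left hF (by positivity) (le_mul_of_one_le_right (by positivity) hN1)
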